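/- Let A be an atomic weakly associative relation algebra and let (U,T) be a complete labelling system for A. Define F(x) = {(u,v) ∈ U×U : (u,a,v) ∈ T for some atom a ≤ x} for each x ∈ A, and let E = F(1). Then E is a symmetric and reflexive relation on U, and F is an injective map from A into {R : R ⊆ E} satisfying, for all x,y ∈ A: F(x+y) = F(x)∪F(y), F(‾x) = E∖F(x), F(1') = Id_U, F(x⌣) = F(x)⁻¹, and F(x;y) = (F(x)|F(y))∩E. Hence F is an embedding of A into Rl_E(Re(U)). -/

import Mathlib

universe u v

/-- A weakly associative relation algebra: a Boolean algebra equipped with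
relative multiplication `comp`, converse `conv`, and identity `one'`
satisfying the WA axioms. -/
structure WA (A : Type*) [BooleanAlgebra A] where
  comp : A → A → A
  conv : A → A
  one' : A
  wassoc : ∀ x : A, comp (comp (x ⊓ one') ⊤) ⊤ = comp (x ⊓ one') ⊤
  rdist : ∀ x y z : A, comp (x ⊔ y) z = comp x z ⊔ comp y z
  comp_one' : ∀ x : A, comp x one' = x
  conv_conv : ∀ x : A, conv (conv x) = x
  conv_sup : ∀ x y : A, conv (x ⊔ y) = conv x ⊔ conv y
  conv_comp : ∀ x y : A, conv (comp x y) = comp (conv y) (conv x)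
  tarski : ∀ x y : A, comp (conv x) (comp x y)ᶜ ≤ yᶜ

/-- A labelling system for a WA `W`: a set of labelled edges
`T ⊆ U × At(A) × U` satisfying conditions (i)--(v). -/
structure LabSys {A : Type*} [BooleanAlgebra A] (W : WA A) (U : Type*) where
  T : Set (U × A × U)
  mem_atom : ∀ ⦃u : U⦄ ⦃a : A⦄ ⦃v : U⦄, (u, a, v) ∈ T → IsAtom a
  functional : ∀ ⦃u : U⦄ ⦃a b : A⦄ ⦃v : U⦄, (u, a, v) ∈ T → (u, b, v) ∈ T → a = b
  ident_exists : ∀ a : A, IsAtom a → a ≤ W.one' → ∃ u : U, (u, a, u) ∈ T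
  ident_iff : ∀ u v : U, u = v ↔ ∃ a : A, IsAtom a ∧ a ≤ W.one' ∧ (u, a, v) ∈ T
  conv_mem : ∀ ⦃u : U⦄ ⦃a : A⦄ ⦃v : U⦄, (u, a, v) ∈ T → (v, W.conv a, u) ∈ T
  triangle : ∀ ⦃u : U⦄ ⦃a : A⦄ ⦃v : U⦄ ⦃b : A⦄ ⦃w : U⦄ ⦃c : A⦄,
    (u, a, v) ∈ T → (v, b, w) ∈ T → (u, c, w) ∈ T → c ≤ W.comp a b

/-- `(u,a,v,b,c)` is a flaw in the labelling system `L`. -/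
def Flaw {A : Type*} [BooleanAlgebra A] (W : WA A) {U : Type*} (L : LabSys W U)
    (u : U) (a : A) (v : U) (b c : A) : Prop :=
  IsAtom a ∧ IsAtom b ∧ IsAtom c ∧ (u, a, v) ∈ L.T ∧ a ≤ W.comp b c ∧
    ∀ w : U, (u, b, w) ∉ L.T ∨ (w, c, v) ∉ L.T

/-- Relational composition of binary relations. -/
def relComp {U : Type*} (R S : Set (U × U)) : Set (U × U) :=
  {p | ∃ w, (p.1, w) ∈ R ∧ (w, p.2) ∈ S}

/-- Inverse of a binary relation. -/
def relInv {U : Type*} (R : Set (U × U)) : Set (U × U) :=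
  {p | (p.2, p.1) ∈ R}

/-- The identity relation. -/
def idRel' {U : Type*} : Set (U × U) :=
  {p | p.1 = p.2}

namespace WA

variable {A : Type*} [BooleanAlgebra A] (W : WA A)

theorem conv_mono {x y : A} (h : x ≤ y) : W.conv x ≤ W.conv y := by
  rw [← sup_eq_right, ← W.conv_sup, sup_eq_right.mpr h]

theorem conv_le_iff {x y : A} : W.conv x ≤ y ↔ x ≤ W.conv y :=
  ⟨fun h => W.conv_conv x ▸ W.conv_mono h, fun h => W.conv_conv y ▸ W.conv_mono h⟩

theorem conv_bot : W.conv ⊥ = ⊥ :=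
  le_bot_iff.mp (W.conv_le_iff.mpr bot_le)

theorem isAtom_conv {a : A} (ha : IsAtom a) : IsAtom (W.conv a) := by
  refine ⟨fun h => ha.1 ?_, fun b hb => ?_⟩
  · rw [← W.conv_conv a, h, W.conv_bot]
  · have hlt : W.conv b < a :=
      lt_of_le_of_ne (W.conv_le_iff.mpr hb.le) fun h => hb.ne (by rw [← h, W.conv_conv])
    rw [← W.conv_conv b, ha.2 _ hlt, W.conv_bot]

theorem comp_mono_left {x y : A} (h : x ≤ y) (z : A) : W.comp x z ≤ W.comp y z := by
  rw [← sup_eq_right, ← W.rdist, sup_eq_right.mpr h]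

theorem comp_mono_right (x : A) {y z : A} (h : y ≤ z) : W.comp x y ≤ W.comp x z := by
  have := W.conv_mono (W.comp_mono_left (W.conv_mono h) (W.conv x))
  simpa only [W.conv_comp, W.conv_conv] using this

theorem comp_mono {x z y w : A} (hx : x ≤ z) (hy : y ≤ w) : W.comp x y ≤ W.comp z w :=
  (W.comp_mono_left hx y).trans (W.comp_mono_right z hy)

/-- One direction of the Peircean law. -/
theorem disjoint_conv_comp {x y z : A} (h : Disjoint z (W.comp x y)) :
    Disjoint (W.comp (W.conv x) z) y :=
  le_compl_iff_disjoint_right.mp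
    ((W.comp_mono_right _ (le_compl_iff_disjoint_right.mpr h)).trans (W.tarski x y))

theorem not_disjoint_comp_conv_one' {a : A} (ha : a ≠ ⊥) :
    ¬ Disjoint W.one' (W.comp a (W.conv a)) := by
  intro h
  have h' := W.disjoint_conv_comp h
  rw [W.comp_one', disjoint_self] at h'
  exact ha (by rw [← W.conv_conv a, h', W.conv_bot])

theorem exists_atom_right (hatomic : ∀ x : A, x ≠ ⊥ → ∃ a : A, IsAtom a ∧ a ≤ x)
    {a x y : A} (ha : IsAtom a) (h : a ≤ W.comp x y) :
    ∃ c, IsAtom c ∧ c ≤ y ∧ a ≤ W.comp x c := by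
  have hne : W.comp (W.conv x) a ⊓ y ≠ ⊥ := fun h0 => by
    have h1 := W.disjoint_conv_comp (disjoint_iff.mpr h0).symm
    rw [W.conv_conv] at h1
    exact ha.1 (disjoint_self.mp (h1.mono_left h))
  obtain ⟨c, hc, hcle⟩ := hatomic _ hne
  refine ⟨c, hc, hcle.trans inf_le_right, ?_⟩
  by_contra hac
  have h1 := W.disjoint_conv_comp (ha.not_le_iff_disjoint.mp hac)
  exact hc.1 (disjoint_self.mp (h1.mono_left (hcle.trans inf_le_left)))

theorem exists_atoms_le_comp (hatomic : ∀ x : A, x ≠ ⊥ → ∃ a : A, IsAtom a ∧ a ≤ x)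
    {a x y : A} (ha : IsAtom a) (h : a ≤ W.comp x y) :
    ∃ b c, IsAtom b ∧ IsAtom c ∧ b ≤ x ∧ c ≤ y ∧ a ≤ W.comp b c := by
  obtain ⟨c, hc, hcy, hac⟩ := W.exists_atom_right hatomic ha h
  have h' : W.conv a ≤ W.comp (W.conv c) (W.conv x) := by
    rw [← W.conv_comp]
    exact W.conv_mono hac
  obtain ⟨b, hb, hbx, hab⟩ := W.exists_atom_right hatomic (W.isAtom_conv ha) h'
  refine ⟨W.conv b, c, W.isAtom_conv hb, hc, W.conv_le_iff.mpr hbx, hcy, ?_⟩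
  rw [W.conv_le_iff, W.conv_comp, W.conv_conv] at hab
  exact hab

end WA

/-- Every atom labels some edge of a complete labelling system. -/
theorem LabSys.exists_mem_of_isAtom {A : Type*} [BooleanAlgebra A] {W : WA A}
    (hatomic : ∀ x : A, x ≠ ⊥ → ∃ a : A, IsAtom a ∧ a ≤ x)
    {U : Type*} (L : LabSys W U)
    (hcomplete : ∀ (u v : U) (a b c : A), ¬ Flaw W L u a v b c)
    {a : A} (ha : IsAtom a) : ∃ u v, (u, a, v) ∈ L.T := by
  obtain ⟨e, he, hle⟩ := hatomic (W.one' ⊓ W.comp a (W.conv a)) fun h =>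
    W.not_disjoint_comp_conv_one' ha.1 (disjoint_iff.mpr h)
  obtain ⟨u, hu⟩ := L.ident_exists e he (hle.trans inf_le_left)
  by_contra! hno
  exact hcomplete u u e a (W.conv a)
    ⟨he, ha, W.isAtom_conv ha, hu, hle.trans inf_le_right, fun w => Or.inl (hno u w)⟩

/-- A complete labelling system for an atomic WA yields an embedding `F` of
the algebra into `Rl_E(Re(U))` where `E = F 1` is symmetric and reflexive. -/
theorem stmt_6 {A : Type u} [BooleanAlgebra A] (W : WA A)
    (hatomic : ∀ x : A, x ≠ ⊥ → ∃ a : A, IsAtom a ∧ a ≤ x)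
    {U : Type v} (L : LabSys W U)
    (hcomplete : ∀ (u v : U) (a b c : A), ¬ Flaw W L u a v b c)
    (F : A → Set (U × U))
    (hF : ∀ x : A, F x = {p | ∃ a : A, IsAtom a ∧ a ≤ x ∧ (p.1, a, p.2) ∈ L.T}) :
    (∀ u v : U, (u, v) ∈ F ⊤ → (v, u) ∈ F ⊤) ∧
    (∀ u v : U, (u, v) ∈ F ⊤ → (u, u) ∈ F ⊤ ∧ (v, v) ∈ F ⊤) ∧
    Function.Injective F ∧
    (∀ x : A, F x ⊆ F ⊤) ∧
    (∀ x y : A, F (x ⊔ y) = F x ∪ F y) ∧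
    (∀ x : A, F xᶜ = F ⊤ \ F x) ∧
    F W.one' = idRel' ∧
    (∀ x : A, F (W.conv x) = relInv (F x)) ∧
    (∀ x y : A, F (W.comp x y) = relComp (F x) (F y) ∩ F ⊤) := by
  have mem (x : A) (u v : U) :
      (u, v) ∈ F x ↔ ∃ a : A, IsAtom a ∧ a ≤ x ∧ (u, a, v) ∈ L.T := by
    rw [hF]; rfl
  have mono {x y : A} (h : x ≤ y) : F x ⊆ F y := by
    rintro ⟨u, v⟩ hp
    obtain ⟨a, ha, hax, hT⟩ := (mem _ _ _).mp hp
    exact (mem _ _ _).mpr ⟨a, ha, hax.trans h, hT⟩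
  have conv_le (x : A) (u v : U) (h : (u, v) ∈ F x) : (v, u) ∈ F (W.conv x) := by
    obtain ⟨a, ha, hax, hT⟩ := (mem _ _ _).mp h
    exact (mem _ _ _).mpr ⟨W.conv a, W.isAtom_conv ha, W.conv_mono hax, L.conv_mem hT⟩
  have diag (u : U) : (u, u) ∈ F ⊤ :=
    mono le_top ((mem W.one' u u).mpr ((L.ident_iff u u).mp rfl))
  have reflects {x y : A} (h : F x ⊆ F y) : x ≤ y := by
    by_contra hxy
    obtain ⟨a, ha, hle⟩ := hatomic (x ⊓ yᶜ) fun h0 =>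
      hxy (disjoint_compl_right_iff.mp (disjoint_iff.mpr h0))
    obtain ⟨u, v, hT⟩ := L.exists_mem_of_isAtom hatomic hcomplete ha
    obtain ⟨b, -, hby, hTb⟩ :=
      (mem _ _ _).mp (h ((mem _ _ _).mpr ⟨a, ha, hle.trans inf_le_left, hT⟩))
    obtain rfl := L.functional hT hTb
    exact ha.1 (disjoint_self.mp (disjoint_compl_right.mono hby (hle.trans inf_le_right)))
  refine ⟨fun u v h => mono le_top (conv_le _ _ _ h), fun u v _ => ⟨diag u, diag v⟩,
    fun x y h => le_antisymm (reflects h.le) (reflects h.ge), fun x => mono le_top,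
    fun x y => ?_, fun x => ?_, ?_, fun x => ?_, fun x y => ?_⟩
  · refine Set.Subset.antisymm ?_ (Set.union_subset (mono le_sup_left) (mono le_sup_right))
    rintro ⟨u, v⟩ hp
    obtain ⟨a, ha, hle, hT⟩ := (mem _ _ _).mp hp
    by_cases hax : a ≤ x
    · exact Or.inl ((mem _ _ _).mpr ⟨a, ha, hax, hT⟩)
    · exact Or.inr ((mem _ _ _).mpr
        ⟨a, ha, (ha.not_le_iff_disjoint.mp hax).left_le_of_le_sup_left hle, hT⟩)
  · ext ⟨u, v⟩
    constructor
    · intro hp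
      refine ⟨mono le_top hp, fun hx => ?_⟩
      obtain ⟨a, ha, hax, hT⟩ := (mem _ _ _).mp hp
      obtain ⟨b, -, hbx, hTb⟩ := (mem _ _ _).mp hx
      obtain rfl := L.functional hT hTb
      exact ha.1 (disjoint_self.mp (disjoint_compl_right.mono hbx hax))
    · rintro ⟨hp, hx⟩
      obtain ⟨a, ha, -, hT⟩ := (mem _ _ _).mp hp
      refine (mem _ _ _).mpr ⟨a, ha, le_compl_iff_disjoint_right.mpr
        (ha.not_le_iff_disjoint.mp fun hax => hx ((mem _ _ _).mpr ⟨a, ha, hax, hT⟩)), hT⟩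
  · ext ⟨u, v⟩
    exact (mem _ _ _).trans (L.ident_iff u v).symm
  · ext ⟨u, v⟩
    exact ⟨fun h => W.conv_conv x ▸ conv_le _ _ _ h, conv_le x v u⟩
  · ext ⟨u, v⟩
    constructor
    · intro hp
      refine ⟨?_, mono le_top hp⟩
      obtain ⟨a, ha, hle, hT⟩ := (mem _ _ _).mp hp
      obtain ⟨b, c, hb, hc, hbx, hcy, habc⟩ := W.exists_atoms_le_comp hatomic ha hle
      by_contra hno
      refine hcomplete u v a b c ⟨ha, hb, hc, hT, habc, fun w => ?_⟩
      by_contra! hw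
      exact hno ⟨w, (mem _ _ _).mpr ⟨b, hb, hbx, hw.1⟩, (mem _ _ _).mpr ⟨c, hc, hcy, hw.2⟩⟩
    · rintro ⟨⟨w, hx, hy⟩, hp⟩
      obtain ⟨a, -, hax, hTa⟩ := (mem _ _ _).mp hx
      obtain ⟨b, -, hby, hTb⟩ := (mem _ _ _).mp hy
      obtain ⟨c, hc, -, hTc⟩ := (mem _ _ _).mp hp
      exact (mem _ _ _).mpr ⟨c, hc, (L.triangle hTa hTb hTc).trans (W.comp_mono hax hby), hTc⟩
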